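/- Let C be an m×n Cauchon diagram. For each k ∈ [n], there is at most one directed path in the Cauchon graph G_C from r_m to c_k; such a path exists if and only if the square (m,k) is white, and in that case its weight equals t_{m,k}. Consequently, M_C[m,k] = t_{m,k} if (m,k) is white and M_C[m,k] = 0 if (m,k) is black. -/

import Mathlib

universe u

/-- Quantum affine space data: a central unit `q` and units `t i j`
satisfying the quantum affine space commutation relations. -/
structure QMData (R : Type u) [Ring R] (m n : ℕ) where
  q : Rˣ
  t : Fin m → Fin n → Rˣ
  q_central : ∀ r : R, (q : R) * r = r * (q : R)
  row_rel : ∀ (i : Fin m) ⦃j j' : Fin n⦄, j < j' →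
    (t i j : R) * (t i j' : R) = (q : R) * ((t i j' : R) * (t i j : R))
  col_rel : ∀ ⦃i i' : Fin m⦄ (j : Fin n), i < i' →
    (t i j : R) * (t i' j : R) = (q : R) * ((t i' j : R) * (t i j : R))
  mixed_rel : ∀ ⦃i i' : Fin m⦄ ⦃j j' : Fin n⦄, i < i' → j ≠ j' →
    (t i j : R) * (t i' j' : R) = (t i' j' : R) * (t i j : R)

/-- `white i j = true` means the square `(i,j)` is white.  The Cauchon
condition: for every black square, either every square above it or every
square to its left is also black. -/
def IsCauchon {m n : ℕ} (white : Fin m → Fin n → Bool) : Prop :=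
  ∀ i j, white i j = false →
    (∀ i' : Fin m, i' < i → white i' j = false) ∨
    (∀ j' : Fin n, j' < j → white i j' = false)

/-- Vertices of the Cauchon graph: white squares, row vertices `r_i`,
column vertices `c_j`. -/
inductive CVertex (m n : ℕ) where
  | sq : Fin m → Fin n → CVertex m n
  | row : Fin m → CVertex m n
  | col : Fin n → CVertex m n
deriving DecidableEq

/-- Directed edges of the Cauchon graph. -/
inductive CEdge {m n : ℕ} (white : Fin m → Fin n → Bool) :
    CVertex m n → CVertex m n → Prop where
  | fromRow (i : Fin m) (k : Fin n) :
      white i k = true → (∀ k' : Fin n, k < k' → white i k' = false) →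
      CEdge white (.row i) (.sq i k)
  | toCol (i : Fin m) (j : Fin n) :
      white i j = true → (∀ i' : Fin m, i < i' → white i' j = false) →
      CEdge white (.sq i j) (.col j)
  | horiz (i : Fin m) (k j : Fin n) :
      j < k → white i k = true → white i j = true →
      (∀ j' : Fin n, j < j' → j' < k → white i j' = false) →
      CEdge white (.sq i k) (.sq i j)
  | vert (i i' : Fin m) (j : Fin n) :
      i < i' → white i j = true → white i' j = true →
      (∀ l : Fin m, i < l → l < i' → white l j = false) →
      CEdge white (.sq i j) (.sq i' j)

/-- The weight of an edge of the Cauchon graph (1 on non-edges). -/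
def wt {R : Type u} {m n : ℕ} [Ring R] (D : QMData R m n) :
    CVertex m n → CVertex m n → R
  | .row i, .sq i' k => if i = i' then (D.t i' k : R) else 1
  | .sq i k, .sq i' j =>
      if i = i' ∧ j < k then (↑((D.t i k)⁻¹) * ↑(D.t i j) : R) else 1
  | _, _ => 1

/-- A pair of vertices spans a horizontal edge (edges from `r_i` are
horizontal; edges between squares are horizontal iff the rows agree). -/
def Horiz {m n : ℕ} : CVertex m n → CVertex m n → Prop
  | .row _, _ => True
  | .sq i _, .sq i' _ => i = i'
  | _, _ => False

/-- `l` is (the list of vertices of) a directed path from `u` to `v`. -/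
def IsPathFrom {m n : ℕ} (white : Fin m → Fin n → Bool) (u v : CVertex m n)
    (l : List (CVertex m n)) : Prop :=
  l.Chain' (CEdge white) ∧ l.head? = some u ∧ l.getLast? = some v

/-- The list of (endpoint pairs of the) edges of a path. -/
def steps {m n : ℕ} (l : List (CVertex m n)) : List (CVertex m n × CVertex m n) :=
  l.zip l.tail

/-- The weight of a path: the ordered product of its edge weights. -/
def pathWeight {R : Type u} {m n : ℕ} [Ring R] (D : QMData R m n)
    (l : List (CVertex m n)) : R :=
  ((steps l).map fun p => wt D p.1 p.2).prod

/-- The number of inversions (length) of a permutation of `Fin k`. -/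
def invCount {k : ℕ} (σ : Equiv.Perm (Fin k)) : ℕ :=
  ((Finset.univ : Finset (Fin k × Fin k)).filter fun p => p.1 < p.2 ∧ σ p.2 < σ p.1).card

/-- The quantum determinant of a `k × k` matrix over a (noncommutative) ring. -/
def qdet {R : Type u} [Ring R] {k : ℕ} (q : Rˣ) (N : Matrix (Fin k) (Fin k) R) : R :=
  ∑ σ : Equiv.Perm (Fin k),
    (-(q : R)) ^ invCount σ * ((List.finRange k).map fun i => N i (σ i)).prod

/-- The path matrix: entry `(i,j)` is the sum of the weights of all directed
paths from `r_i` to `c_j` (zero when there are none). -/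
noncomputable def pathMatrix {R : Type u} {m n : ℕ} [Ring R] (D : QMData R m n)
    (white : Fin m → Fin n → Bool) : Matrix (Fin m) (Fin n) R :=
  Matrix.of fun i j =>
    ∑ᶠ p : {l : List (CVertex m n) // IsPathFrom white (.row i) (.col j) l},
      pathWeight D p.1

/-- An `(R_I, C_J)`-path system: paths `P ℓ : r_{i_ℓ} ⇒ c_{j_{σ ℓ}}`. -/
structure PathSys {m n : ℕ} (white : Fin m → Fin n → Bool) {k : ℕ}
    (ι : Fin k → Fin m) (κ : Fin k → Fin n) where
  σ : Equiv.Perm (Fin k)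
  P : Fin k → List (CVertex m n)
  isPath : ∀ l : Fin k, IsPathFrom white (.row (ι l)) (.col (κ (σ l))) (P l)

/-- A path system is vertex-disjoint if no two of its paths share a vertex. -/
def PathSys.VertexDisjoint {m n : ℕ} {white : Fin m → Fin n → Bool} {k : ℕ}
    {ι : Fin k → Fin m} {κ : Fin k → Fin n} (S : PathSys white ι κ) : Prop :=
  ∀ a b : Fin k, a ≠ b → ∀ x : CVertex m n, x ∈ S.P a → x ∈ S.P b → False

/-- The weight of a path system: the ordered product `w(P₁)⋯w(P_k)`. -/
def PathSys.weight {R : Type u} {m n : ℕ} [Ring R] (D : QMData R m n)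
    {white : Fin m → Fin n → Bool} {k : ℕ} {ι : Fin k → Fin m} {κ : Fin k → Fin n}
    (S : PathSys white ι κ) : R :=
  ((List.finRange k).map fun l => pathWeight D (S.P l)).prod

/-- The `q`-sign of a path system: `(-q) ^ ℓ(σ_P)`. -/
def PathSys.sgnq {R : Type u} {m n : ℕ} [Ring R] (D : QMData R m n)
    {white : Fin m → Fin n → Bool} {k : ℕ} {ι : Fin k → Fin m} {κ : Fin k → Fin n}
    (S : PathSys white ι κ) : R :=
  (-(D.q : R)) ^ invCount S.σ

theorem isPathFrom_cons {m n : ℕ} {white : Fin m → Fin n → Bool} {u v w : CVertex m n}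
    {l : List (CVertex m n)} (e : CEdge white u w) (h : IsPathFrom white w v l) :
    IsPathFrom white u v (u :: l) := by
  obtain ⟨hc, hh, hl⟩ := h
  match l, hh with
  | x :: l', hh =>
    obtain rfl : x = w := by simpa using hh
    exact ⟨List.isChain_cons_cons.2 ⟨e, hc⟩, rfl, by simpa using hl⟩

/-- A path between distinct vertices splits into its first edge and a shorter path. -/
theorem IsPathFrom.exists_cons {m n : ℕ} {white : Fin m → Fin n → Bool} {u v : CVertex m n}
    {l : List (CVertex m n)} (h : IsPathFrom white u v l) (huv : u ≠ v) :
    ∃ w l', l = u :: l' ∧ CEdge white u w ∧ IsPathFrom white w v l' := by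
  obtain ⟨hc, hh, hl⟩ := h
  match l, hh with
  | [x], hh =>
    simp only [List.head?_cons, Option.some.injEq] at hh
    simp only [List.getLast?_singleton, Option.some.injEq] at hl
    exact absurd (hh.symm.trans hl) huv
  | x :: w :: l', hh =>
    obtain rfl : x = u := by simpa using hh
    obtain ⟨e, hc'⟩ := List.isChain_cons_cons.1 hc
    exact ⟨w, w :: l', rfl, e, hc', rfl, by simpa using hl⟩

/-- Column vertices are sinks, so only the trivial path starts at one. -/
theorem IsPathFrom.of_col {m n : ℕ} {white : Fin m → Fin n → Bool} {j : Fin n}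
    {v : CVertex m n} {l : List (CVertex m n)} (h : IsPathFrom white (.col j) v l) :
    v = .col j ∧ l = [.col j] := by
  obtain ⟨hc, hh, hl⟩ := h
  match l, hh with
  | [x], hh =>
    obtain rfl : x = .col j := by simpa using hh
    exact ⟨by simpa using hl.symm, rfl⟩
  | x :: w :: l', hh =>
    obtain rfl : x = .col j := by simpa using hh
    nomatch (List.isChain_cons_cons.1 hc).1

theorem pathWeight_cons {R : Type*} [Ring R] {m n : ℕ} (D : QMData R m n)
    {white : Fin m → Fin n → Bool} {w v : CVertex m n} {l : List (CVertex m n)}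
    (h : IsPathFrom white w v l) (u : CVertex m n) :
    pathWeight D (u :: l) = wt D u w * pathWeight D l := by
  obtain ⟨-, hh, -⟩ := h
  match l, hh with
  | x :: l', hh =>
    obtain rfl : x = w := by simpa using hh
    simp [pathWeight, steps]

/-- A path from a square of the last row to a column vertex either ends immediately below that
square or first moves to the nearest white square to its left. -/
theorem IsPathFrom.sq_last_cases {m n : ℕ} {white : Fin (m + 1) → Fin n → Bool} {j k : Fin n}
    {l : List (CVertex (m + 1) n)}
    (h : IsPathFrom white (.sq (Fin.last m) j) (.col k) l) :
    (j = k ∧ white (Fin.last m) k = true ∧ l = [.sq (Fin.last m) k, .col k]) ∨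
      ∃ j' l', j' < j ∧ white (Fin.last m) j' = true ∧
        (∀ i, j' < i → i < j → white (Fin.last m) i = false) ∧
        l = .sq (Fin.last m) j :: l' ∧
        IsPathFrom white (.sq (Fin.last m) j') (.col k) l' := by
  obtain ⟨w, l', rfl, e, h'⟩ := h.exists_cons (by simp)
  cases e with
  | toCol _ _ hw _ =>
    obtain ⟨hk, rfl⟩ := h'.of_col
    obtain rfl : k = j := by simpa using hk
    exact .inl ⟨rfl, hw, rfl⟩
  | horiz _ _ j' hlt _ hw hb => exact .inr ⟨j', l', hlt, hw, hb, rfl, h'⟩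
  | vert _ i' _ hlt => exact absurd hlt (Fin.le_last i').not_gt

theorem IsPathFrom.le_and_white {m n : ℕ} {white : Fin (m + 1) → Fin n → Bool} {j k : Fin n}
    {l : List (CVertex (m + 1) n)}
    (h : IsPathFrom white (.sq (Fin.last m) j) (.col k) l) :
    k ≤ j ∧ white (Fin.last m) k = true := by
  induction l generalizing j with
  | nil => simp [IsPathFrom] at h
  | cons x l ih =>
    rcases h.sq_last_cases with ⟨rfl, hw, -⟩ | ⟨j', l', hlt, -, -, hl, h'⟩
    · exact ⟨le_rfl, hw⟩
    · obtain ⟨rfl, rfl⟩ := List.cons.inj hl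
      exact (ih h').imp_left fun hle => hle.trans hlt.le

theorem IsPathFrom.pathWeight_of_sq_last {R : Type*} [Ring R] {m n : ℕ}
    (D : QMData R (m + 1) n) {white : Fin (m + 1) → Fin n → Bool} {j k : Fin n}
    {l : List (CVertex (m + 1) n)}
    (h : IsPathFrom white (.sq (Fin.last m) j) (.col k) l) :
    pathWeight D l = ↑(D.t (Fin.last m) j)⁻¹ * (D.t (Fin.last m) k : R) := by
  induction l generalizing j with
  | nil => simp [IsPathFrom] at h
  | cons x l ih =>
    rcases h.sq_last_cases with ⟨rfl, -, hl⟩ | ⟨j', l', hlt, -, -, hl, h'⟩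
    · simp [hl, pathWeight, steps, wt]
    · obtain ⟨rfl, rfl⟩ := List.cons.inj hl
      rw [pathWeight_cons D h', ih h']
      simp [wt, hlt, mul_assoc]

theorem IsPathFrom.eq_of_sq_last {m n : ℕ} {white : Fin (m + 1) → Fin n → Bool} {j k : Fin n}
    {l₁ l₂ : List (CVertex (m + 1) n)}
    (h₁ : IsPathFrom white (.sq (Fin.last m) j) (.col k) l₁)
    (h₂ : IsPathFrom white (.sq (Fin.last m) j) (.col k) l₂) : l₁ = l₂ := by
  induction l₁ generalizing j l₂ with
  | nil => simp [IsPathFrom] at h₁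
  | cons x l ih =>
    rcases h₁.sq_last_cases with ⟨hj, -, hl⟩ | ⟨j₁, l', hlt₁, hw₁, hb₁, hl, h₁'⟩ <;>
      rcases h₂.sq_last_cases with ⟨hj', -, hl₂⟩ | ⟨j₂, l'', hlt₂, hw₂, hb₂, hl₂, h₂'⟩
    · rw [hl, hl₂]
    · exact absurd h₂'.le_and_white.1 (hj ▸ hlt₂).not_ge
    · exact absurd h₁'.le_and_white.1 (hj' ▸ hlt₁).not_ge
    · obtain ⟨rfl, rfl⟩ := List.cons.inj hl
      obtain rfl : j₁ = j₂ := by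
        rcases lt_trichotomy j₁ j₂ with h | h | h
        · simp [hb₁ _ h hlt₂] at hw₂
        · exact h
        · simp [hb₂ _ h hlt₁] at hw₁
      rw [hl₂, ih h₁' h₂']

theorem exists_last_of_exists {n : ℕ} {p : Fin n → Prop} {k : Fin n} (hk : p k) :
    ∃ j, k ≤ j ∧ p j ∧ ∀ i, j < i → ¬ p i := by
  obtain ⟨j, hkj, hj⟩ := (Set.toFinite {i | p i}).exists_le_maximal hk
  exact ⟨j, hkj, hj.prop, fun i hi h => hj.not_prop_of_gt hi h⟩

theorem exists_isPathFrom_sq_last {m n : ℕ} {white : Fin (m + 1) → Fin n → Bool} {j k : Fin n}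
    (hj : white (Fin.last m) j = true) (hk : white (Fin.last m) k = true) (hkj : k ≤ j) :
    ∃ l, IsPathFrom white (.sq (Fin.last m) j) (.col k) l := by
  induction j using WellFoundedLT.induction with
  | ind j ih =>
    rcases hkj.eq_or_lt with rfl | hlt
    · exact ⟨_, isPathFrom_cons
        (.toCol _ _ hk fun i hi => absurd hi (Fin.le_last i).not_gt)
        ⟨List.isChain_singleton _, rfl, rfl⟩⟩
    · obtain ⟨i, hki, ⟨hij, hi⟩, hmax⟩ := exists_last_of_exists
        (p := fun i => i < j ∧ white (Fin.last m) i = true) ⟨hlt, hk⟩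
      obtain ⟨l, hl⟩ := ih i hij hi hki
      exact ⟨_, isPathFrom_cons
        (.horiz _ _ _ hij hj hi fun i' h h' => by simpa [h'] using hmax i' h) hl⟩

theorem IsPathFrom.row_cases {m n : ℕ} {white : Fin m → Fin n → Bool} {i : Fin m} {k : Fin n}
    {l : List (CVertex m n)} (h : IsPathFrom white (.row i) (.col k) l) :
    ∃ j l', white i j = true ∧ (∀ j', j < j' → white i j' = false) ∧ l = .row i :: l' ∧
      IsPathFrom white (.sq i j) (.col k) l' := by
  obtain ⟨w, l', rfl, e, h'⟩ := h.exists_cons (by simp)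
  cases e with
  | fromRow _ j hw hb => exact ⟨j, l', hw, hb, rfl, h'⟩

theorem IsPathFrom.eq_of_row_last {m n : ℕ} {white : Fin (m + 1) → Fin n → Bool} {k : Fin n}
    {l₁ l₂ : List (CVertex (m + 1) n)}
    (h₁ : IsPathFrom white (.row (Fin.last m)) (.col k) l₁)
    (h₂ : IsPathFrom white (.row (Fin.last m)) (.col k) l₂) : l₁ = l₂ := by
  obtain ⟨j₁, l₁, hw₁, hb₁, rfl, h₁'⟩ := h₁.row_cases
  obtain ⟨j₂, l₂, hw₂, hb₂, rfl, h₂'⟩ := h₂.row_cases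
  obtain rfl : j₁ = j₂ := by
    rcases lt_trichotomy j₁ j₂ with h | h | h
    · simp [hb₁ _ h] at hw₂
    · exact h
    · simp [hb₂ _ h] at hw₁
  rw [h₁'.eq_of_sq_last h₂']

theorem IsPathFrom.white_and_pathWeight_of_row_last {R : Type*} [Ring R] {m n : ℕ}
    (D : QMData R (m + 1) n) {white : Fin (m + 1) → Fin n → Bool} {k : Fin n}
    {l : List (CVertex (m + 1) n)} (h : IsPathFrom white (.row (Fin.last m)) (.col k) l) :
    white (Fin.last m) k = true ∧ pathWeight D l = (D.t (Fin.last m) k : R) := by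
  obtain ⟨j, l', -, -, rfl, h'⟩ := h.row_cases
  refine ⟨h'.le_and_white.2, ?_⟩
  rw [pathWeight_cons D h', h'.pathWeight_of_sq_last D]
  simp [wt]

theorem exists_isPathFrom_row_last {m n : ℕ} {white : Fin (m + 1) → Fin n → Bool} {k : Fin n}
    (hk : white (Fin.last m) k = true) :
    ∃ l, IsPathFrom white (.row (Fin.last m)) (.col k) l := by
  obtain ⟨j, hkj, hj, hmax⟩ := exists_last_of_exists
    (p := fun i => white (Fin.last m) i = true) hk
  obtain ⟨l, hl⟩ := exists_isPathFrom_sq_last hj hk hkj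
  exact ⟨_, isPathFrom_cons (.fromRow _ _ hj fun i hi => by simpa using hmax i hi) hl⟩

/-- in the last row there is at most one path `r_m ⇒ c_k`; it
exists iff `(m,k)` is white, has weight `t_{m,k}`, and correspondingly
`M_C[m,k] = t_{m,k}` or `0`. -/
theorem last_row_path_matrix {R : Type u} [Ring R] {m n : ℕ} (D : QMData R (m + 1) n)
    (white : Fin (m + 1) → Fin n → Bool) (hC : IsCauchon white) (k : Fin n) :
    (∀ l1 l2 : List (CVertex (m + 1) n),
        IsPathFrom white (.row (Fin.last m)) (.col k) l1 →
        IsPathFrom white (.row (Fin.last m)) (.col k) l2 → l1 = l2) ∧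
    ((∃ l, IsPathFrom white (.row (Fin.last m)) (.col k) l) ↔
        white (Fin.last m) k = true) ∧
    (∀ l, IsPathFrom white (.row (Fin.last m)) (.col k) l →
        pathWeight D l = (D.t (Fin.last m) k : R)) ∧
    pathMatrix D white (Fin.last m) k =
      (if white (Fin.last m) k = true then (D.t (Fin.last m) k : R) else 0) := by
  refine ⟨fun l₁ l₂ h₁ h₂ => h₁.eq_of_row_last h₂,
    ⟨fun ⟨l, h⟩ => (h.white_and_pathWeight_of_row_last D).1, exists_isPathFrom_row_last⟩,
    fun l h => (h.white_and_pathWeight_of_row_last D).2, ?_⟩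
  rw [pathMatrix, Matrix.of_apply]
  split_ifs with hk
  · obtain ⟨l, hl⟩ := exists_isPathFrom_row_last hk
    rw [finsum_eq_single _ ⟨l, hl⟩ fun p hp => absurd (Subtype.ext (p.2.eq_of_row_last hl)) hp]
    exact (hl.white_and_pathWeight_of_row_last D).2
  · have : IsEmpty {l // IsPathFrom white (.row (Fin.last m)) (.col k) l} :=
      ⟨fun p => hk (p.2.white_and_pathWeight_of_row_last D).1⟩
    exact finsum_of_isEmpty _
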